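/- The smallest possible critical exponent of an infinite balanced word over a 5-letter alphabet is 3/2: there exists an infinite balanced word over {0,1,2,3,4} whose critical exponent equals 3/2 (namely x_5), and every infinite balanced word over a 5-letter alphabet has critical exponent at least 3/2. -/

import Mathlib

/-- The characteristic Sturmian word with slope `α = √2 - 1`, indexed from 1:
`c_α[n] = ⌊α(n+1)⌋ - ⌊αn⌋`. -/
noncomputable def calpha (n : ℕ) : ℤ :=
  ⌊(Real.sqrt 2 - 1) * ((n : ℝ) + 1)⌋ - ⌊(Real.sqrt 2 - 1) * (n : ℝ)⌋

/-- `zcount m` = number of indices `1 ≤ j ≤ m` with `c_α[j] = 0`. -/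
noncomputable def zcount (m : ℕ) : ℕ :=
  ((Finset.Icc 1 m).filter fun j => calpha j = 0).card

/-- `ocount m` = number of indices `1 ≤ j ≤ m` with `c_α[j] = 1`. -/
noncomputable def ocount (m : ℕ) : ℕ :=
  ((Finset.Icc 1 m).filter fun j => calpha j = 1).card

/-- The infinite balanced word `x₅` over `{0,1,2,3,4}`, indexed from 0, obtained from
`c_α` by replacing the 0's by `(0102)^ω` and the 1's by `(34)^ω`. -/
noncomputable def x5 (i : ℕ) : ℕ :=
  if calpha (i + 1) = 0 then [0, 1, 0, 2].getD ((zcount (i + 1) - 1) % 4) 0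
  else [3, 4].getD ((ocount (i + 1) - 1) % 2) 0

/-- Number of occurrences of the symbol `a` in the length-`n` factor of `x₅`
starting at position `i`. -/
noncomputable def x5occ (a i n : ℕ) : ℕ :=
  ((Finset.range n).filter fun j => x5 (i + j) = a).card

/-- Number of occurrences of `a` in the prefix of length `n` of `w`. -/
def prefixCount {α : Type*} [DecidableEq α] (w : ℕ → α) (a : α) (n : ℕ) : ℕ :=
  ((Finset.range n).filter fun j => w j = a).card

section PrefixCount

variable {α : Type*} [DecidableEq α] (w : ℕ → α) (a : α)

theorem prefixCount_succ (n : ℕ) :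
    prefixCount w a (n + 1) = prefixCount w a n + if w n = a then 1 else 0 := by
  simp only [prefixCount, Finset.card_filter, Finset.sum_range_succ]

theorem prefixCount_add (i n : ℕ) :
    prefixCount w a (i + n) =
      prefixCount w a i + ((Finset.range n).filter fun j => w (i + j) = a).card := by
  simp only [prefixCount, Finset.card_filter, Finset.sum_range_add]

theorem prefixCount_le (n : ℕ) : prefixCount w a n ≤ n := by
  simpa [prefixCount] using Finset.card_filter_le (Finset.range n) fun j => w j = a

/-- Any two factors of `w` of equal length have numbers of `a` differing by at most one. -/
def BalancedAt : Prop :=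
  ∀ i j n : ℕ, prefixCount w a (i + n) + prefixCount w a j ≤
    prefixCount w a (j + n) + prefixCount w a i + 1

theorem balancedAt_iff : BalancedAt w a ↔ ∀ i i' n : ℕ,
    ((((Finset.range n).filter fun j => w (i + j) = a).card : ℤ) -
      (((Finset.range n).filter fun j => w (i' + j) = a).card : ℤ)).natAbs ≤ 1 := by
  constructor
  · intro h i j n
    have h1 := h i j n
    have h2 := h j i n
    rw [prefixCount_add, prefixCount_add] at h1 h2
    omega
  · intro h i j n
    have := h i j n
    rw [prefixCount_add, prefixCount_add]
    omega

/-- No factor of `w` has exponent at least `3/2`. -/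
def AvoidsThreeHalves : Prop :=
  ∀ i p : ℕ, 1 ≤ p → ¬ ∀ j < (p + 1) / 2, w (i + j) = w (i + j + p)

end PrefixCount

theorem BalancedAt.comp_equiv {α β : Type*} [DecidableEq α] [DecidableEq β] {w : ℕ → α}
    (e : α ≃ β) {a : α} (h : BalancedAt w a) : BalancedAt (fun n => e (w n)) (e a) := by
  simpa [BalancedAt, prefixCount] using h

theorem AvoidsThreeHalves.comp_equiv {α β : Type*} {w : ℕ → α} (e : α ≃ β)
    (h : AvoidsThreeHalves w) : AvoidsThreeHalves (fun n => e (w n)) := by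
  simpa [AvoidsThreeHalves] using h

/-- The slope `√2 - 1` of the Sturmian word `calpha`. -/
noncomputable def silverSlope : ℝ := Real.sqrt 2 - 1

theorem silverSlope_sq : silverSlope ^ 2 = 1 - 2 * silverSlope := by
  have := Real.sq_sqrt (show (0 : ℝ) ≤ 2 by norm_num)
  unfold silverSlope
  linear_combination this

theorem silverSlope_gt : 0.4142135 < silverSlope := by
  have : (1.4142135 : ℝ) < Real.sqrt 2 := Real.lt_sqrt_of_sq_lt (by norm_num)
  unfold silverSlope
  linarith

theorem silverSlope_lt : silverSlope < 0.4142136 := by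
  have : Real.sqrt 2 < 1.4142136 := (Real.sqrt_lt' (by norm_num)).mpr (by norm_num)
  unfold silverSlope
  linarith

theorem calpha_eq_zero_or_one (n : ℕ) : calpha n = 0 ∨ calpha n = 1 := by
  have h1 := Int.floor_le ((Real.sqrt 2 - 1) * ((n : ℝ) + 1))
  have h2 := Int.lt_floor_add_one ((Real.sqrt 2 - 1) * ((n : ℝ) + 1))
  have h3 := Int.floor_le ((Real.sqrt 2 - 1) * (n : ℝ))
  have h4 := Int.lt_floor_add_one ((Real.sqrt 2 - 1) * (n : ℝ))
  have h5 := silverSlope_gt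
  have h6 := silverSlope_lt
  unfold calpha
  unfold silverSlope at h5 h6
  generalize ⌊(Real.sqrt 2 - 1) * ((n : ℝ) + 1)⌋ = u at *
  generalize ⌊(Real.sqrt 2 - 1) * (n : ℝ)⌋ = v at *
  have h7 : (u : ℝ) < ((v + 2 : ℤ) : ℝ) := by push_cast; linarith
  have h8 : ((v - 1 : ℤ) : ℝ) < (u : ℝ) := by push_cast; linarith
  have h7 := Int.cast_lt.mp h7
  have h8 := Int.cast_lt.mp h8
  omega

theorem ocount_succ (m : ℕ) :
    ocount (m + 1) = ocount m + if calpha (m + 1) = 1 then 1 else 0 := by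
  simp only [ocount, Finset.card_filter]
  rw [Finset.sum_Icc_succ_top (by omega)]

theorem zcount_succ (m : ℕ) :
    zcount (m + 1) = zcount m + if calpha (m + 1) = 0 then 1 else 0 := by
  simp only [zcount, Finset.card_filter]
  rw [Finset.sum_Icc_succ_top (by omega)]

theorem zcount_add_ocount (m : ℕ) : zcount m + ocount m = m := by
  induction m with
  | zero => simp [zcount, ocount]
  | succ m ih =>
    rw [zcount_succ, ocount_succ]
    rcases calpha_eq_zero_or_one (m + 1) with h | h <;> simp [h] <;> omega

theorem ocount_eq_floor (m : ℕ) : (ocount m : ℤ) = ⌊silverSlope * ((m : ℝ) + 1)⌋ := by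
  induction m with
  | zero =>
    symm
    rw [Int.floor_eq_iff]
    have := silverSlope_gt
    have := silverSlope_lt
    constructor <;> simp [ocount] <;> linarith
  | succ m ih =>
    have h : calpha (m + 1) = ⌊silverSlope * (((m + 1 : ℕ) : ℝ) + 1)⌋ - ⌊silverSlope * ((m : ℝ) + 1)⌋ := by
      simp [calpha, silverSlope]
    rw [ocount_succ]
    generalize ⌊silverSlope * (((m + 1 : ℕ) : ℝ) + 1)⌋ = u at *
    generalize ⌊silverSlope * ((m : ℝ) + 1)⌋ = v at *
    rcases calpha_eq_zero_or_one (m + 1) with h' | h' <;> simp [h'] <;> omega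

theorem ocount_le (m : ℕ) : (ocount m : ℝ) ≤ silverSlope * ((m : ℝ) + 1) := by
  have := Int.floor_le (silverSlope * ((m : ℝ) + 1))
  rw [← ocount_eq_floor] at this
  exact_mod_cast this

theorem lt_ocount_add_one (m : ℕ) : silverSlope * ((m : ℝ) + 1) < ocount m + 1 := by
  have := Int.lt_floor_add_one (silverSlope * ((m : ℝ) + 1))
  rw [← ocount_eq_floor] at this
  exact_mod_cast this

theorem x5_eq (i : ℕ) : x5 i = if ocount (i + 1) = ocount i then
    [0, 1, 0, 2].getD (zcount i % 4) 0 else [3, 4].getD (ocount i % 2) 0 := by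
  rw [x5, ocount_succ, zcount_succ]
  rcases calpha_eq_zero_or_one (i + 1) with h | h <;> simp [h]

theorem x5_cases (i : ℕ) :
    (ocount (i + 1) = ocount i ∧ zcount (i + 1) = zcount i + 1 ∧
      x5 i = [0, 1, 0, 2].getD (zcount i % 4) 0) ∨
    (ocount (i + 1) = ocount i + 1 ∧ zcount (i + 1) = zcount i ∧
      x5 i = [3, 4].getD (ocount i % 2) 0) := by
  rw [x5_eq, ocount_succ, zcount_succ]
  rcases calpha_eq_zero_or_one (i + 1) with h | h <;> simp [h]

theorem prefixCount_x5 (n : ℕ) :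
    prefixCount x5 0 n = (zcount n + 1) / 2 ∧ prefixCount x5 1 n = (zcount n + 2) / 4 ∧
    prefixCount x5 2 n = zcount n / 4 ∧ prefixCount x5 3 n = (ocount n + 1) / 2 ∧
    prefixCount x5 4 n = ocount n / 2 := by
  induction n with
  | zero => simp [prefixCount, zcount, ocount]
  | succ n ih =>
    simp only [prefixCount_succ]
    obtain ⟨h0, h1, h2, h3, h4⟩ := ih
    rw [h0, h1, h2, h3, h4]
    rcases x5_cases n with ⟨e1, e2, e3⟩ | ⟨e1, e2, e3⟩ <;> rw [e1, e2, e3]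
    · have : zcount n % 4 < 4 := Nat.mod_lt _ (by norm_num)
      interval_cases h : zcount n % 4 <;> simp <;> omega
    · have : ocount n % 2 < 2 := Nat.mod_lt _ (by norm_num)
      interval_cases h : ocount n % 2 <;> simp <;> omega

theorem balancedAt_of_bounds {α : Type*} [DecidableEq α] {w : ℕ → α} {a : α} (β : ℝ)
    (h : ∀ m n : ℕ, |(prefixCount w a (m + n) : ℝ) - prefixCount w a m - β * n| < 1) :
    BalancedAt w a := by
  intro i j n
  have h1 := (abs_lt.mp (h i n)).2
  have h2 := (abs_lt.mp (h j n)).1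
  have h3 : ((prefixCount w a (i + n) + prefixCount w a j : ℕ) : ℝ) <
      ((prefixCount w a (j + n) + prefixCount w a i + 2 : ℕ) : ℝ) := by
    push_cast; linarith
  have := Nat.cast_lt.mp h3
  omega

theorem natCast_div_bounds (a d : ℕ) (hd : 0 < d) :
    (d : ℝ) * (a / d : ℕ) ≤ a ∧ (a : ℝ) + 1 ≤ d * (a / d : ℕ) + d := by
  have h1 := Nat.div_add_mod a d
  have h2 := Nat.mod_lt a hd
  constructor
  · exact_mod_cast (by omega : d * (a / d) ≤ a)
  · exact_mod_cast (by omega : a + 1 ≤ d * (a / d) + d)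

theorem abs_ocount_div_lt (c d : ℕ) (hd : 0 < d) (m n : ℕ) :
    |((((ocount (m + n) + c) / d : ℕ) : ℝ)) - ((ocount m + c) / d : ℕ) - silverSlope / d * n| < 1 := by
  have h1 := natCast_div_bounds (ocount (m + n) + c) d hd
  have h2 := natCast_div_bounds (ocount m + c) d hd
  have h3 := ocount_le (m + n)
  have h4 := lt_ocount_add_one (m + n)
  have h5 := ocount_le m
  have h6 := lt_ocount_add_one m
  have hd' : (0 : ℝ) < d := by exact_mod_cast hd
  generalize (ocount (m + n) + c) / d = u at *
  generalize (ocount m + c) / d = v at *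
  push_cast at *
  have e : (d : ℝ) * (u - v - silverSlope / d * n) = d * u - d * v - silverSlope * n := by field_simp
  have e' : |(d : ℝ) * (u - v - silverSlope / d * n)| < d := by
    rw [e, abs_lt]; constructor <;> linarith
  rw [abs_mul, abs_of_pos hd'] at e'
  exact (mul_lt_iff_lt_one_right hd').mp e'

theorem abs_zcount_div_lt (c d : ℕ) (hd : 0 < d) (m n : ℕ) :
    |((((zcount (m + n) + c) / d : ℕ) : ℝ)) - ((zcount m + c) / d : ℕ) -
      (1 - silverSlope) / d * n| < 1 := by
  have h1 := natCast_div_bounds (zcount (m + n) + c) d hd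
  have h2 := natCast_div_bounds (zcount m + c) d hd
  have h3 := ocount_le (m + n)
  have h4 := lt_ocount_add_one (m + n)
  have h5 := ocount_le m
  have h6 := lt_ocount_add_one m
  have h7 : (zcount (m + n) : ℝ) + ocount (m + n) = m + n := by
    exact_mod_cast zcount_add_ocount (m + n)
  have h8 : (zcount m : ℝ) + ocount m = m := by exact_mod_cast zcount_add_ocount m
  have hd' : (0 : ℝ) < d := by exact_mod_cast hd
  generalize (zcount (m + n) + c) / d = u at *
  generalize (zcount m + c) / d = v at *
  push_cast at *
  have e : (d : ℝ) * (u - v - (1 - silverSlope) / d * n) = d * u - d * v - (1 - silverSlope) * n := by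
    field_simp
  have e' : |(d : ℝ) * (u - v - (1 - silverSlope) / d * n)| < d := by
    rw [e, abs_lt]; constructor <;> linarith
  rw [abs_mul, abs_of_pos hd'] at e'
  exact (mul_lt_iff_lt_one_right hd').mp e'

theorem balancedAt_x5 (a : ℕ) (ha : a < 5) : BalancedAt x5 a := by
  have h := prefixCount_x5
  interval_cases a
  · refine balancedAt_of_bounds ((1 - silverSlope) / (2 : ℕ)) fun m n => ?_
    simp only [(h _).1]
    exact abs_zcount_div_lt 1 2 (by norm_num) m n
  · refine balancedAt_of_bounds ((1 - silverSlope) / (4 : ℕ)) fun m n => ?_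
    simp only [(h _).2.1]
    exact abs_zcount_div_lt 2 4 (by norm_num) m n
  · refine balancedAt_of_bounds ((1 - silverSlope) / (4 : ℕ)) fun m n => ?_
    simp only [(h _).2.2.1]
    exact abs_zcount_div_lt 0 4 (by norm_num) m n
  · refine balancedAt_of_bounds (silverSlope / (2 : ℕ)) fun m n => ?_
    simp only [(h _).2.2.2.1]
    exact abs_ocount_div_lt 1 2 (by norm_num) m n
  · refine balancedAt_of_bounds (silverSlope / (2 : ℕ)) fun m n => ?_
    simp only [(h _).2.2.2.2]
    exact abs_ocount_div_lt 0 2 (by norm_num) m n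

/-- The sequence `1, 0, 1, 2, 5, 12, …` of Pell numbers, starting one step before `0`. -/
def pell : ℕ → ℕ
  | 0 => 1
  | 1 => 0
  | k + 2 => 2 * pell (k + 1) + pell k

theorem pell_add_two (k : ℕ) : pell (k + 2) = 2 * pell (k + 1) + pell k := rfl

theorem pell_pos (k : ℕ) : 0 < pell (k + 2) := by
  induction k with
  | zero => decide
  | succ k ih =>
    have : pell (k + 3) = 2 * pell (k + 2) + pell (k + 1) := rfl
    change 0 < pell (k + 3)
    omega

theorem exists_pell_le_lt {n : ℕ} (hn : 1 ≤ n) : ∃ k, pell (k + 2) ≤ n ∧ n < pell (k + 3) := by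
  induction n, hn using Nat.le_induction with
  | base => exact ⟨0, by decide⟩
  | succ n _ ih =>
    obtain ⟨k, h1, h2⟩ := ih
    by_cases h : n + 1 < pell (k + 3)
    · exact ⟨k, by omega, h⟩
    · have h3 : pell (k + 4) = 2 * pell (k + 3) + pell (k + 2) := rfl
      have h4 : 0 < pell (k + 3) := pell_pos (k + 1)
      exact ⟨k + 1, (by omega : pell (k + 3) ≤ n + 1), (by omega : n + 1 < pell (k + 4))⟩

theorem exists_pell_coordinates (k : ℕ) (p o : ℤ) (h : Even (p + o)) :
    ∃ a b : ℤ, p = a * pell (k + 2) + b * pell (k + 1) ∧ o = a * pell (k + 1) + b * pell k ∧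
      Even (a + b) := by
  induction k with
  | zero => exact ⟨p, o, by simp [pell], by simp [pell], h⟩
  | succ k ih =>
    obtain ⟨a, b, h1, h2, h3⟩ := ih
    refine ⟨b, a - 2 * b, ?_, ?_, ?_⟩
    · rw [pell_add_two (k + 1), h1]; push_cast; ring
    · rw [h2, pell_add_two k]; push_cast; ring
    · rw [Int.even_iff] at *; omega

theorem pell_mul_silverSlope_sub (k : ℕ) :
    pell (k + 1) * silverSlope - pell k = (-1) ^ (k + 1) * silverSlope ^ k := by
  induction k using Nat.twoStepInduction with
  | zero => simp [pell]
  | one => simp [pell]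
  | more k h1 h2 =>
    rw [pell_add_two (k + 1), pell_add_two k] at *
    push_cast at *
    linear_combination 2 * h2 + h1 - (-1) ^ (k + 1) * silverSlope ^ k * silverSlope_sq

theorem silverSlope_pow (k : ℕ) :
    silverSlope ^ k = 2 * silverSlope ^ (k + 1) + silverSlope ^ (k + 2) := by
  linear_combination (-silverSlope ^ k) * silverSlope_sq

theorem silverSlope_pow_bounds (k : ℕ) : 0 < silverSlope ^ (k + 1) ∧
    2 * silverSlope ^ (k + 1) ≤ silverSlope ^ k ∧ silverSlope ^ k ≤ 3 * silverSlope ^ (k + 1) := by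
  have h : 0 < silverSlope := by linarith [silverSlope_gt]
  have h0 := pow_pos h k
  have h1 := pow_pos h (k + 1)
  refine ⟨h1, ?_, ?_⟩ <;> rw [pow_succ] at *
  · nlinarith [silverSlope_lt]
  · nlinarith [silverSlope_gt]

/-- Any `n` consecutive points of a rotation orbit with angle `silverSlope` visit every half-open
arc of length `ε`. -/
def Hits (n : ℕ) (ε : ℝ) : Prop :=
  ∀ x y : ℝ, ∃ j < n, ∃ z : ℤ, y ≤ x + j * silverSlope - z ∧ x + j * silverSlope - z < y + ε

theorem Hits.shift {n s t : ℕ} {ε c : ℝ} (h : Hits n ε)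
    (h1 : c ≤ |s * silverSlope - t|) (h2 : |s * silverSlope - t| + c ≤ ε) :
    Hits (n + s) (ε - c) := by
  intro x y
  rcases le_total 0 (s * silverSlope - t) with hd | hd
  · rw [abs_of_nonneg hd] at h1 h2
    obtain ⟨j, hj, z, hz1, hz2⟩ := h x (y - c)
    by_cases hy : y ≤ x + j * silverSlope - z
    · exact ⟨j, by omega, z, hy, by linarith⟩
    · exact ⟨j + s, by omega, z + t, by push_cast; linarith, by push_cast; linarith⟩
  · rw [abs_of_nonpos hd] at h1 h2
    obtain ⟨j, hj, z, hz1, hz2⟩ := h x y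
    by_cases hy : x + j * silverSlope - z < y + (ε - c)
    · exact ⟨j, by omega, z, hz1, hy⟩
    · exact ⟨j + s, by omega, z + t, by push_cast; linarith, by push_cast; linarith⟩

theorem abs_pell_mul_sub (k : ℕ) :
    |pell (k + 1) * silverSlope - pell k| = silverSlope ^ k := by
  have h : 0 < silverSlope := by linarith [silverSlope_gt]
  rw [pell_mul_silverSlope_sub, abs_mul, abs_pow, abs_neg, abs_one, one_pow, one_mul,
    abs_of_pos (pow_pos h k)]

theorem Hits.of_short {k : ℕ} (h : Hits (pell (k + 2)) (silverSlope ^ k + silverSlope ^ (k + 1))) :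
    Hits (pell (k + 2) + pell (k + 1)) (silverSlope ^ k) := by
  have hb := silverSlope_pow_bounds k
  have := h.shift (s := pell (k + 1)) (t := pell k) (c := silverSlope ^ (k + 1))
    (by rw [abs_pell_mul_sub]; linarith) (by rw [abs_pell_mul_sub])
  rwa [add_sub_cancel_right] at this

theorem hits_short (k : ℕ) : Hits (pell (k + 2)) (silverSlope ^ k + silverSlope ^ (k + 1)) := by
  induction k with
  | zero =>
    intro x y
    have h1 := Int.floor_le (x - y)
    have h2 := Int.lt_floor_add_one (x - y)
    have := silverSlope_gt
    exact ⟨0, by decide, ⌊x - y⌋, by simp; linarith, by simp; linarith⟩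
  | succ k ih =>
    have hb := silverSlope_pow_bounds k
    have := ih.of_short.shift (s := pell (k + 2)) (t := pell (k + 1)) (c := silverSlope ^ (k + 1))
      (by rw [abs_pell_mul_sub]) (by rw [abs_pell_mul_sub]; linarith)
    have e : pell (k + 3) = pell (k + 2) + pell (k + 1) + pell (k + 2) := by
      have : pell (k + 3) = 2 * pell (k + 2) + pell (k + 1) := rfl
      omega
    change Hits (pell (k + 3)) _
    rw [e]
    convert this using 1
    linarith [silverSlope_pow k]

theorem hits_long (k : ℕ) : Hits (pell (k + 2) + pell (k + 1)) (silverSlope ^ k) :=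
  (hits_short k).of_short

theorem Hits.mono {m n : ℕ} {ε : ℝ} (h : Hits m ε) (hmn : m ≤ n) : Hits n ε := by
  intro x y
  obtain ⟨j, hj, hz⟩ := h x y
  exact ⟨j, by omega, hz⟩

theorem le_two_mul_abs {a b : ℤ} {e f : ℝ} (he : 0 < e) (h2 : 2 * e ≤ f) (h3 : f ≤ 3 * e)
    (hab : Even (a + b)) (h0 : a ≠ 0 ∨ b ≠ 0) (hs : ¬ (1 ≤ a ∧ 1 ≤ b)) (hs' : ¬ (a ≤ -1 ∧ b ≤ -1)) :
    f + e ≤ 2 * |a * e - b * f| := by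
  wlog ha : 0 ≤ a generalizing a b
  · have := @this (-a) (-b) (by rw [Int.even_iff] at *; omega) (by omega) (by omega) (by omega)
      (by omega)
    push_cast at this
    rwa [← abs_neg, show -(-(a : ℝ) * e - -b * f) = a * e - b * f by ring] at this
  rw [Int.even_iff] at hab
  rcases lt_trichotomy b 0 with hb | hb | hb
  · have hb' : (b : ℝ) ≤ -1 := by exact_mod_cast (by omega : b ≤ -1)
    have := le_abs_self (a * e - b * f)
    rcases ha.eq_or_lt with rfl | ha
    · have : (b : ℝ) ≤ -2 := by exact_mod_cast (by omega : b ≤ -2)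
      push_cast at *
      nlinarith
    · have : (1 : ℝ) ≤ a := by exact_mod_cast ha
      nlinarith
  · have : (2 : ℝ) ≤ a := by exact_mod_cast (by omega : 2 ≤ a)
    have := le_abs_self (a * e - b * f)
    subst hb
    push_cast at *
    nlinarith
  · have : a = 0 := by omega
    have : (2 : ℝ) ≤ b := by exact_mod_cast (by omega : 2 ≤ b)
    have := neg_abs_le (a * e - b * f)
    subst a
    push_cast at *
    nlinarith

theorem exists_hits {p : ℕ} {o : ℤ} (hp : 1 ≤ p) (ho : Even (p + o)) :
    ∃ ε > 0, ε ≤ 2 * |silverSlope * p - o| ∧ Hits p ε := by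
  obtain ⟨k, hk1, hk2⟩ := exists_pell_le_lt hp
  obtain ⟨a, b, hpa, hob, hab⟩ := exists_pell_coordinates k p o ho
  obtain ⟨he, h2, h3⟩ := silverSlope_pow_bounds k
  have hd : |silverSlope * p - o| = |a * silverSlope ^ (k + 1) - b * silverSlope ^ k| := by
    have e : silverSlope * p - o =
        (-1) ^ k * (a * silverSlope ^ (k + 1) - b * silverSlope ^ k) := by
      have hpa' : (p : ℝ) = a * pell (k + 2) + b * pell (k + 1) := by exact_mod_cast hpa
      have hob' : (o : ℝ) = a * pell (k + 1) + b * pell k := by exact_mod_cast hob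
      rw [hpa', hob']
      linear_combination a * pell_mul_silverSlope_sub (k + 1) + b * pell_mul_silverSlope_sub k
    rw [e, abs_mul, abs_pow, abs_neg, abs_one, one_pow, one_mul]
  rw [hd]
  have hpos := pell_pos k
  rw [pell_add_two (k + 1)] at hk2
  have h0 : a ≠ 0 ∨ b ≠ 0 := by
    by_contra! h
    rw [h.1, h.2] at hpa
    omega
  have hs' : ¬ (a ≤ -1 ∧ b ≤ -1) := by
    rintro ⟨ha, hb⟩
    nlinarith [Int.natCast_nonneg (pell (k + 1)), Int.natCast_nonneg (pell (k + 2))]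
  by_cases hs : 1 ≤ a ∧ 1 ≤ b
  · obtain ⟨ha, hb⟩ := hs
    refine ⟨silverSlope ^ k, by linarith, ?_, (hits_long k).mono ?_⟩
    · have ha' : a = 1 := by
        by_contra ha'
        have : 2 ≤ a := by omega
        zify at hk2
        nlinarith [Int.natCast_nonneg (pell (k + 1)), Int.natCast_nonneg (pell (k + 2))]
      have hb' : (1 : ℝ) ≤ b := by exact_mod_cast hb
      have := neg_abs_le (a * silverSlope ^ (k + 1) - b * silverSlope ^ k)
      rw [ha'] at this ⊢
      push_cast at *
      nlinarith
    · zify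
      nlinarith [Int.natCast_nonneg (pell (k + 1)), Int.natCast_nonneg (pell (k + 2))]
  · exact ⟨_, by linarith, (by linarith [le_two_mul_abs he h2 h3 hab h0 hs hs']),
      (hits_short k).mono hk1⟩

theorem not_constant_difference {i p : ℕ} {o : ℤ} {n : ℕ} {ε : ℝ} (hn : Hits n ε) (hn0 : 0 < n)
    (hε : 0 < ε) (h : ε ≤ |silverSlope * p - o|)
    (ho : ∀ j < n, (ocount (i + j + p) : ℤ) = ocount (i + j) + o) : False := by
  have key : ∀ j < n, (ocount (i + j) : ℝ) ≤ silverSlope * (i + 1) + j * silverSlope ∧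
      silverSlope * (i + 1) + j * silverSlope < ocount (i + j) + 1 ∧
      ocount (i + j) ≤ silverSlope * (i + 1) + j * silverSlope + (silverSlope * p - o) ∧
      silverSlope * (i + 1) + j * silverSlope + (silverSlope * p - o) < ocount (i + j) + 1 := by
    intro j hj
    have e : (ocount (i + j + p) : ℝ) = ocount (i + j) + o := by exact_mod_cast ho j hj
    have h1 := ocount_le (i + j)
    have h2 := lt_ocount_add_one (i + j)
    have h3 := ocount_le (i + j + p)
    have h4 := lt_ocount_add_one (i + j + p)
    rw [e] at h3 h4
    push_cast at *
    refine ⟨?_, ?_, ?_, ?_⟩ <;> linarith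
  generalize silverSlope * p - o = δ at *
  have floor_eq : ∀ {a b : ℤ} {y : ℝ}, a ≤ y → y < a + 1 → b ≤ y → y < b + 1 → a = b := by
    intro a b y h1 h2 h3 h4
    have h5 : (a : ℝ) < (b + 1 : ℤ) := by push_cast; linarith
    have h6 : (b : ℝ) < (a + 1 : ℤ) := by push_cast; linarith
    have h5 := Int.cast_lt.mp h5
    have h6 := Int.cast_lt.mp h6
    omega
  obtain ⟨k1, k2, k3, k4⟩ := key 0 hn0
  rcases le_total 0 δ with hδ | hδ
  · rw [abs_of_nonneg hδ] at h
    obtain ⟨j, hj, z, hz1, hz2⟩ := hn (silverSlope * (i + 1)) (1 - ε)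
    obtain ⟨j1, j2, j3, j4⟩ := key j hj
    have hz : (z : ℤ) = (ocount (i + j) : ℤ) := by
      apply floor_eq (y := silverSlope * (i + 1) + j * silverSlope) <;> push_cast <;> linarith
    rw [hz] at hz1
    push_cast at hz1
    linarith
  · rw [abs_of_nonpos hδ] at h
    obtain ⟨j, hj, z, hz1, hz2⟩ := hn (silverSlope * (i + 1)) 0
    obtain ⟨j1, j2, j3, j4⟩ := key j hj
    have hz : (z : ℤ) = (ocount (i + j) : ℤ) := by
      apply floor_eq (y := silverSlope * (i + 1) + j * silverSlope) <;> push_cast <;> linarith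
    rw [hz] at hz2
    push_cast at hz2
    linarith

theorem ocount_add_bounds (m r : ℕ) :
    (ocount (m + r) : ℝ) < ocount m + silverSlope * r + 1 ∧
      ocount m + silverSlope * r < ocount (m + r) + 1 := by
  have h1 := ocount_le m
  have h2 := lt_ocount_add_one m
  have h3 := ocount_le (m + r)
  have h4 := lt_ocount_add_one (m + r)
  push_cast at *
  constructor <;> linarith

theorem ocount_add_nat_bounds {a b r : ℕ} (m : ℕ) (ha : (a : ℝ) ≤ 0.4142135 * r)
    (hb : 0.4142136 * r ≤ (b : ℝ)) : ocount m + a ≤ ocount (m + r) ∧ ocount (m + r) ≤ ocount m + b := by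
  obtain ⟨h1, h2⟩ := ocount_add_bounds m r
  have h3 := silverSlope_gt
  have h4 := silverSlope_lt
  have hr : (0 : ℝ) ≤ r := Nat.cast_nonneg r
  constructor
  · have : ((ocount m + a : ℕ) : ℝ) < ((ocount (m + r) + 1 : ℕ) : ℝ) := by push_cast; nlinarith
    exact Nat.lt_succ_iff.mp (Nat.cast_lt.mp this)
  · have : ((ocount (m + r) : ℕ) : ℝ) < ((ocount m + b + 1 : ℕ) : ℝ) := by push_cast; nlinarith
    exact Nat.lt_succ_iff.mp (Nat.cast_lt.mp this)

theorem x5_eq_imp {i k : ℕ} (h : x5 i = x5 k) :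
    (ocount (i + 1) = ocount i ∧ ocount (k + 1) = ocount k ∧
      (zcount i % 4 = zcount k % 4 ∨ zcount i % 2 = 0 ∧ zcount k % 2 = 0)) ∨
    (ocount (i + 1) = ocount i + 1 ∧ ocount (k + 1) = ocount k + 1 ∧
      ocount i % 2 = ocount k % 2) := by
  have hi : zcount i % 4 < 4 := Nat.mod_lt _ (by norm_num)
  have hk : zcount k % 4 < 4 := Nat.mod_lt _ (by norm_num)
  have hi' : ocount i % 2 < 2 := Nat.mod_lt _ (by norm_num)
  have hk' : ocount k % 2 < 2 := Nat.mod_lt _ (by norm_num)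
  rcases x5_cases i with ⟨e1, -, e3⟩ | ⟨e1, -, e3⟩ <;>
    rcases x5_cases k with ⟨f1, -, f3⟩ | ⟨f1, -, f3⟩ <;> rw [e3, f3] at h
  · refine Or.inl ⟨e1, f1, ?_⟩
    interval_cases hz : zcount i % 4 <;> interval_cases hz' : zcount k % 4 <;> simp at h ⊢ <;> omega
  · exfalso
    interval_cases zcount i % 4 <;> interval_cases ocount k % 2 <;> simp at h
  · exfalso
    interval_cases ocount i % 2 <;> interval_cases zcount k % 4 <;> simp at h
  · refine Or.inr ⟨e1, f1, ?_⟩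
    interval_cases ocount i % 2 <;> interval_cases ocount k % 2 <;> simp at h ⊢

theorem ocount_step (m : ℕ) : ocount m ≤ ocount (m + 2) ∧ ocount (m + 2) ≤ ocount m + 1 ∧
    ocount m + 1 ≤ ocount (m + 3) ∧ ocount (m + 4) ≤ ocount m + 2 ∧
    ocount m + 2 ≤ ocount (m + 5) ∧ ocount (m + 7) ≤ ocount m + 3 := by
  have h2 := ocount_add_nat_bounds (a := 0) (b := 1) (r := 2) m (by norm_num) (by norm_num)
  have h3 := ocount_add_nat_bounds (a := 1) (b := 2) (r := 3) m (by norm_num) (by norm_num)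
  have h4 := ocount_add_nat_bounds (a := 1) (b := 2) (r := 4) m (by norm_num) (by norm_num)
  have h5 := ocount_add_nat_bounds (a := 2) (b := 3) (r := 5) m (by norm_num) (by norm_num)
  have h7 := ocount_add_nat_bounds (a := 2) (b := 3) (r := 7) m (by norm_num) (by norm_num)
  omega

theorem not_short_period {i p : ℕ} (hp : 1 ≤ p) (hp5 : p ≤ 5)
    (h : ∀ j, 2 * j ≤ p → x5 (i + j) = x5 (i + j + p)) : False := by
  have z0 := zcount_add_ocount i
  have z1 := zcount_add_ocount (i + 1)
  have z2 := zcount_add_ocount (i + 2)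
  have z3 := zcount_add_ocount (i + 3)
  have z4 := zcount_add_ocount (i + 4)
  have z5 := zcount_add_ocount (i + 5)
  have z6 := zcount_add_ocount (i + 6)
  have z7 := zcount_add_ocount (i + 7)
  have s0 := ocount_step i
  have s1 := ocount_step (i + 1)
  have s2 := ocount_step (i + 2)
  have s3 := ocount_step (i + 3)
  have s4 := ocount_step (i + 4)
  have s5 := ocount_step (i + 5)
  have s6 := ocount_step (i + 6)
  simp only [Nat.add_assoc, Nat.reduceAdd] at s0 s1 s2 s3 s4 s5 s6
  have h0 := x5_eq_imp (h 0 (by omega))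
  interval_cases p
  · simp only [Nat.add_assoc, Nat.reduceAdd, Nat.add_zero] at h0
    omega
  · have h1 := x5_eq_imp (h 1 (by omega))
    simp only [Nat.add_assoc, Nat.reduceAdd, Nat.add_zero] at h0 h1
    omega
  · have h1 := x5_eq_imp (h 1 (by omega))
    simp only [Nat.add_assoc, Nat.reduceAdd, Nat.add_zero] at h0 h1
    omega
  · have h1 := x5_eq_imp (h 1 (by omega))
    have h2 := x5_eq_imp (h 2 (by omega))
    simp only [Nat.add_assoc, Nat.reduceAdd, Nat.add_zero] at h0 h1 h2
    omega
  · have h1 := x5_eq_imp (h 1 (by omega))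
    have h2 := x5_eq_imp (h 2 (by omega))
    simp only [Nat.add_assoc, Nat.reduceAdd, Nat.add_zero] at h0 h1 h2
    omega

theorem period_step {m p : ℕ} {o : ℤ} (h : x5 m = x5 (m + p))
    (ho : (ocount (m + p) : ℤ) = ocount m + o) :
    (ocount (m + 1 + p) : ℤ) = ocount (m + 1) + o ∧
    (ocount (m + 1) = ocount m ∧ zcount (m + 1) = zcount m + 1 ∧
        ((p - o) % 4 = 0 ∨ (p - o) % 2 = 0 ∧ zcount m % 2 = 0) ∨
      ocount (m + 1) = ocount m + 1 ∧ zcount (m + 1) = zcount m ∧ o % 2 = 0) := by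
  have z0 := zcount_add_ocount m
  have z1 := zcount_add_ocount (m + 1)
  have z2 := zcount_add_ocount (m + p)
  rw [Nat.add_right_comm m 1 p]
  rcases x5_eq_imp h with h | h <;> omega

theorem period_congruences {i p : ℕ} {o : ℤ} (ho : (ocount (i + p) : ℤ) = ocount i + o)
    (h : ∀ j < 4, x5 (i + j) = x5 (i + j + p)) : o % 2 = 0 ∧ (p - o) % 4 = 0 := by
  obtain ⟨e1, h0⟩ := period_step (h 0 (by omega)) ho
  obtain ⟨e2, h1⟩ := period_step (h 1 (by omega)) e1
  obtain ⟨e3, h2⟩ := period_step (h 2 (by omega)) e2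
  obtain ⟨-, h3⟩ := period_step (h 3 (by omega)) e3
  have s0 := ocount_step i
  clear ho e1 e2 e3 h
  simp only [Nat.add_assoc, Nat.reduceAdd, Nat.add_zero] at *
  generalize (p : ℤ) - o = e at *
  constructor <;> omega

theorem exponent_x5_le {i n p : ℕ} (hp : 1 ≤ p)
    (h : ∀ j, j + p < n → x5 (i + j) = x5 (i + j + p)) : 2 * n ≤ 3 * p := by
  by_contra! hn
  have h' : ∀ j, 2 * j ≤ p → x5 (i + j) = x5 (i + j + p) := fun j hj => h j (by omega)
  by_cases hp5 : p ≤ 5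
  · exact not_short_period hp hp5 h'
  obtain ⟨o, ho⟩ : ∃ o : ℤ, (ocount (i + p) : ℤ) = ocount i + o :=
    ⟨ocount (i + p) - ocount i, by omega⟩
  obtain ⟨h1, h2⟩ := period_congruences ho fun j hj => h' j (by omega)
  have hconst : ∀ j, 2 * j ≤ p → (ocount (i + j + p) : ℤ) = ocount (i + j) + o := by
    intro j
    induction j with
    | zero => exact fun _ => ho
    | succ j ih => exact fun hj => (period_step (h' j (by omega)) (ih (by omega))).1
  obtain ⟨p', rfl⟩ : ∃ p', p = 2 * p' := ⟨p / 2, by omega⟩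
  obtain ⟨o', rfl⟩ : ∃ o', o = 2 * o' := ⟨o / 2, by omega⟩
  obtain ⟨ε, hε, hle, hits⟩ := exists_hits (p := p') (o := o') (by omega)
    (by rw [Int.even_iff]; push_cast at *; omega)
  refine not_constant_difference (i := i) hits (by omega) hε ?_ fun j hj => hconst j (by omega)
  rw [← abs_two, ← abs_mul] at hle
  rwa [show silverSlope * ((2 * p' : ℕ) : ℝ) - ((2 * o' : ℤ) : ℝ) = 2 * (silverSlope * p' - o') by
    push_cast; ring]

theorem ocount_eq {m k : ℕ} (h1 : (k : ℝ) ≤ 0.4142135 * (m + 1))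
    (h2 : 0.4142136 * ((m : ℝ) + 1) ≤ k + 1) : ocount m = k := by
  have h3 := ocount_le m
  have h4 := lt_ocount_add_one m
  have h5 := silverSlope_gt
  have h6 := silverSlope_lt
  have h7 : (ocount m : ℝ) < ((k + 1 : ℕ) : ℝ) := by push_cast; nlinarith
  have h8 : (k : ℝ) < ((ocount m + 1 : ℕ) : ℝ) := by push_cast; nlinarith
  have h7 := Nat.cast_lt.mp h7
  have h8 := Nat.cast_lt.mp h8
  omega

theorem x5_ten_period (j : ℕ) (hj : j + 4 < 6) : x5 (10 + j) = x5 (10 + j + 4) := by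
  have o10 : ocount 10 = 4 := ocount_eq (by norm_num) (by norm_num)
  have o11 : ocount 11 = 4 := ocount_eq (by norm_num) (by norm_num)
  have o12 : ocount 12 = 5 := ocount_eq (by norm_num) (by norm_num)
  have o14 : ocount 14 = 6 := ocount_eq (by norm_num) (by norm_num)
  have o15 : ocount 15 = 6 := ocount_eq (by norm_num) (by norm_num)
  have o16 : ocount 16 = 7 := ocount_eq (by norm_num) (by norm_num)
  have z10 : zcount 10 = 6 := by have := zcount_add_ocount 10; omega
  have z14 : zcount 14 = 8 := by have := zcount_add_ocount 14; omega
  obtain rfl | rfl : j = 0 ∨ j = 1 := by omega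
  · simp [x5_eq, o10, o11, o14, o15, z10, z14]
  · simp [x5_eq, o11, o12, o15, o16]

/-- The word coded in base `8` by `w` ends with a repetition of period `p` and exponent `≥ 3/2`. -/
def endsRep (w p : ℕ) : Bool :=
  Nat.beq (Nat.mod (Nat.div w (Nat.pow 8 p)) (Nat.pow 8 (Nat.div (Nat.succ p) 2)))
    (Nat.mod w (Nat.pow 8 (Nat.div (Nat.succ p) 2)))

/-- The coded word ends with a repetition of exponent `≥ 3/2` and one of the listed periods. -/
def endsSomeRep (w : ℕ) : Bool :=
  [1, 2, 3, 4, 5, 6, 7, 9, 10, 11, 12, 13, 16, 17, 18, 20, 21, 28, 30].any (endsRep w)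

/-- All base-`64` digits of `X` below the length of the repunit coded by `R` are `0`, `1` or `2`
(one direction only: bits `0` and `1` of a digit are not both set). -/
def smallDigits (X R : ℕ) : Bool :=
  Nat.beq (Nat.land (Nat.land X (Nat.div X 2)) (Nat.mul 17043521 R)) 0

/-- Digit by digit, one more than the number of each letter in the last window minus that in each
earlier window, where `s, P, p` code letter counts as in `countCode` and `countSeqCode`. -/
def windowDiffs (s P p b R : ℕ) : ℕ :=
  Nat.sub (Nat.add (Nat.mul R (Nat.sub (Nat.add 17043521 s) (Nat.mod p 1073741824))) p)
    (Nat.mod P b)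

/-- Some window count differs from the one of the last window by more than one. -/
def unbalancedAux (s P p b R : ℕ) : Bool :=
  !(smallDigits (windowDiffs s P p b R) R)

/-- The last window of length `L` of the coded word of length `n` violates balance. -/
def unbalancedAt (n s P L : ℕ) : Bool :=
  Nat.ble L n &&
    unbalancedAux s P (Nat.div P (Nat.pow 1073741824 L))
      (Nat.pow 1073741824 (Nat.sub (Nat.succ n) L))
      (Nat.div (Nat.pred (Nat.pow 1073741824 (Nat.sub (Nat.succ n) L))) 1073741823)

/-- The last window of one of the listed lengths violates balance. -/
def unbalanced (n s P : ℕ) : Bool :=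
  [4, 5, 6, 7, 8, 9, 11].any (unbalancedAt n s P)

/-- The coded word ends with a repetition of exponent `≥ 3/2` or is seen to be unbalanced. -/
def rejected (n w s P : ℕ) : Bool :=
  endsSomeRep w || unbalanced n s P

/-- Backtracking search: every extension by at most `m` letters of the word of length `n` coded by
`w, s, P`, whose letters are `u` with `v` still unused, is rejected at some point. Unused letters
are introduced in the order of `v`. -/
def exhausted : ℕ → List ℕ → List ℕ → ℕ → ℕ → ℕ → ℕ → Bool
  | 0, _, _, _, _, _, _ => false
  | m + 1, u, v, n, w, s, P =>
    let visit : List ℕ → List ℕ → ℕ → Bool := fun u v x =>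
      let s' := Nat.add s (Nat.pow 64 (Nat.pred x))
      let w' := Nat.add (Nat.mul 8 w) x
      let P' := Nat.add (Nat.mul 1073741824 P) s'
      rejected (Nat.succ n) w' s' P' || exhausted m u v (Nat.succ n) w' s' P'
    u.all (visit u v) &&
      match v with
      | [] => true
      | e :: v' => visit (e :: u) v' e

theorem exhausted_empty : exhausted 45 [] [1, 2, 3, 4, 5] 0 0 0 0 = true := by decide +kernel

section Coding

variable (f : ℕ → Fin 5)

/-- The base-`8` code of the prefix of length `n` of `f`. -/
def wordCode : ℕ → ℕ
  | 0 => 0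
  | n + 1 => 8 * wordCode n + (f n + 1)

/-- The numbers of each letter in the prefix of length `n` of `f`, as base-`64` digits. -/
def countCode : ℕ → ℕ
  | 0 => 0
  | n + 1 => countCode n + 64 ^ (f n : ℕ)

/-- Concatenation in base `2 ^ 30` of the codes `countCode f 0, …, countCode f n`. -/
def countSeqCode : ℕ → ℕ
  | 0 => 0
  | n + 1 => 2 ^ 30 * countSeqCode n + countCode f (n + 1)

theorem wordCode_div (n p : ℕ) : wordCode f n / 8 ^ p = wordCode f (n - p) := by
  induction p generalizing n with
  | zero => simp
  | succ p ih =>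
    rw [pow_succ', ← Nat.div_div_eq_div_mul]
    cases n with
    | zero => simp [wordCode]
    | succ n =>
      have : wordCode f (n + 1) / 8 = wordCode f n := by
        have := (f n).isLt
        simp only [wordCode]; omega
      rw [this, ih, Nat.succ_sub_succ]

theorem eq_of_wordCode_mod_eq (r n m : ℕ) (hmn : m < n)
    (h : wordCode f n % 8 ^ r = wordCode f m % 8 ^ r) :
    r ≤ m ∧ ∀ j < r, f (m - r + j) = f (n - r + j) := by
  induction r generalizing n m with
  | zero => simp
  | succ r ih =>
    obtain ⟨n, rfl⟩ : ∃ k, n = k + 1 := ⟨n - 1, by omega⟩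
    have hn := (f n).isLt
    cases m with
    | zero =>
      exfalso
      have h8 := congrArg (· % 8) h
      simp only [pow_succ', Nat.mod_mul_right_mod, wordCode] at h8
      omega
    | succ m =>
      have hm := (f m).isLt
      simp only [pow_succ', Nat.mod_mul, wordCode] at h
      have e1 : (8 * wordCode f n + ((f n : ℕ) + 1)) / 8 = wordCode f n := by omega
      have e2 : (8 * wordCode f m + ((f m : ℕ) + 1)) / 8 = wordCode f m := by omega
      rw [e1, e2] at h
      have hd : (f n : ℕ) = f m := by omega
      have hr : wordCode f n % 8 ^ r = wordCode f m % 8 ^ r := by omega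
      obtain ⟨h1, h2⟩ := ih n m (by omega) hr
      refine ⟨by omega, fun j hj => ?_⟩
      rcases Nat.lt_succ_iff_lt_or_eq.mp hj with hj | rfl
      · simpa using h2 j hj
      · have a1 : m + 1 - (j + 1) + j = m := by omega
        have a2 : n + 1 - (j + 1) + j = n := by omega
        rw [a1, a2]
        exact Fin.ext hd.symm

theorem endsRep_eq_false (hf : AvoidsThreeHalves f) {n p : ℕ} (hn : 1 ≤ n) (hp : 1 ≤ p) :
    endsRep (wordCode f n) p = false := by
  by_contra h
  rw [Bool.not_eq_false] at h
  replace h : wordCode f n / 8 ^ p % 8 ^ ((p + 1) / 2) = wordCode f n % 8 ^ ((p + 1) / 2) :=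
    Nat.eq_of_beq_eq_true h
  rw [wordCode_div] at h
  obtain ⟨h1, h2⟩ := eq_of_wordCode_mod_eq f _ n (n - p) (by omega) h.symm
  refine hf (n - p - (p + 1) / 2) p hp fun j hj => ?_
  have e : n - p - (p + 1) / 2 + j + p = n - (p + 1) / 2 + j := by omega
  rw [e]
  exact h2 j hj

theorem countCode_eq (n : ℕ) : countCode f n = ∑ a : Fin 5, 64 ^ (a : ℕ) * prefixCount f a n := by
  induction n with
  | zero => simp [countCode, prefixCount]
  | succ n ih =>
    simp only [countCode, ih, prefixCount_succ, mul_add, Finset.sum_add_distrib]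
    simp

theorem countSeqCode_div (n p : ℕ) (hn : n < 64) :
    countSeqCode f n / (2 ^ 30) ^ p = countSeqCode f (n - p) := by
  induction p generalizing n with
  | zero => simp
  | succ p ih =>
    rw [pow_succ', ← Nat.div_div_eq_div_mul]
    cases n with
    | zero => simp [countSeqCode]
    | succ n =>
      have : countSeqCode f (n + 1) / 2 ^ 30 = countSeqCode f n := by
        have := countCode_eq f (n + 1)
        simp only [Fin.sum_univ_five] at this
        have h0 := prefixCount_le f 0 (n + 1)
        have h1 := prefixCount_le f 1 (n + 1)
        have h2 := prefixCount_le f 2 (n + 1)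
        have h3 := prefixCount_le f 3 (n + 1)
        have h4 := prefixCount_le f 4 (n + 1)
        simp only [countSeqCode]; norm_num at *; omega
      rw [this, ih _ (by omega), Nat.succ_sub_succ]

end Coding

/-- Concatenation of the blocks `a 0, …, a (k - 1)` in base `2 ^ 30`. -/
def concatBlocks (a : ℕ → ℕ) : ℕ → ℕ
  | 0 => 0
  | k + 1 => 2 ^ 30 * concatBlocks a k + a k

theorem concatBlocks_lt (a : ℕ → ℕ) (k : ℕ) (h : ∀ i < k, a i < 2 ^ 30) :
    concatBlocks a k < (2 ^ 30) ^ k := by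
  induction k with
  | zero => simp [concatBlocks]
  | succ k ih =>
    have h1 := ih fun i hi => h i (by omega)
    have h2 := h k (by omega)
    simp only [concatBlocks, pow_succ' (2 ^ 30)]
    omega

theorem concatBlocks_one (k : ℕ) :
    ((2 ^ 30) ^ k - 1) / (2 ^ 30 - 1) = concatBlocks (fun _ => 1) k := by
  have h : (2 ^ 30 - 1) * concatBlocks (fun _ => 1) k + 1 = (2 ^ 30) ^ k := by
    induction k with
    | zero => simp [concatBlocks]
    | succ k ih => simp only [concatBlocks, pow_succ' (2 ^ 30)]; omega
  rw [← h, Nat.add_sub_cancel, Nat.mul_div_cancel_left _ (by norm_num)]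

theorem concatBlocks_add_mul {a b c : ℕ → ℕ} {t k : ℕ}
    (h : ∀ i < k, a i + b i = t + c i) :
    concatBlocks a k + concatBlocks b k =
      concatBlocks (fun _ => 1) k * t + concatBlocks c k := by
  induction k with
  | zero => simp [concatBlocks]
  | succ k ih =>
    have h1 := ih fun i hi => h i (by omega)
    have h2 := h k (by omega)
    simp only [concatBlocks]
    linear_combination 2 ^ 30 * h1 + h2

theorem concatBlocks_const_mul (c k : ℕ) :
    c * concatBlocks (fun _ => 1) k = concatBlocks (fun _ => c) k := by
  induction k with
  | zero => simp [concatBlocks]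
  | succ k ih => simp only [concatBlocks, ← ih]; ring

theorem block_digits : ∀ c₀ c₁ c₂ c₃ c₄ : Fin 3,
    ((c₀ + 64 * c₁ + 4096 * c₂ + 262144 * c₃ + 16777216 * c₄ : ℕ) &&&
      ((c₀ + 64 * c₁ + 4096 * c₂ + 262144 * c₃ + 16777216 * c₄ : ℕ) / 2)) &&& 17043521 = 0 := by
  decide +kernel

theorem smallDigits_concatBlocks (a : ℕ → ℕ) (k : ℕ)
    (h : ∀ i < k, a i < 2 ^ 30 ∧ (a i &&& (a i / 2)) &&& 17043521 = 0) :
    smallDigits (concatBlocks a k) (concatBlocks (fun _ => 1) k) = true := by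
  suffices (concatBlocks a k &&& (concatBlocks a k / 2)) &&&
      concatBlocks (fun _ => 17043521) k = 0 by
    rw [← concatBlocks_const_mul] at this
    exact Eq.mpr Nat.beq_eq this
  induction k with
  | zero => simp [concatBlocks]
  | succ k ih =>
    obtain ⟨h1, h2⟩ := h k (by omega)
    have ih := ih fun i hi => h i (by omega)
    simp only [concatBlocks]
    refine Nat.eq_of_testBit_eq fun t => ?_
    have e1 := congrArg (Nat.testBit · t) h2
    have e2 := congrArg (Nat.testBit · (t - 30)) ih
    simp only [Nat.testBit_land, Nat.testBit_div_two, Nat.zero_testBit,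
      Nat.testBit_two_pow_mul_add _ h1,
      Nat.testBit_two_pow_mul_add (b := 17043521) (i := 30) _ (by norm_num)] at e1 e2 ⊢
    rcases lt_trichotomy t 29 with ht | rfl | ht
    · rw [if_pos (by omega), if_pos (by omega), if_pos (by omega)]
      exact e1
    · have : Nat.testBit 17043521 29 = false := by decide
      simp [this]
    · rw [if_neg (by omega), if_neg (by omega), if_neg (by omega)]
      rwa [show t - 30 + 1 = t + 1 - 30 by omega] at e2

section Balance

variable (f : ℕ → Fin 5)

theorem countCode_lt (n : ℕ) (hn : n < 64) : countCode f n < 2 ^ 30 := by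
  have := countCode_eq f n
  simp only [Fin.sum_univ_five] at this
  have h0 := prefixCount_le f 0 n
  have h1 := prefixCount_le f 1 n
  have h2 := prefixCount_le f 2 n
  have h3 := prefixCount_le f 3 n
  have h4 := prefixCount_le f 4 n
  norm_num at *; omega

theorem countSeqCode_eq (n : ℕ) : countSeqCode f n = concatBlocks (countCode f) (n + 1) := by
  induction n with
  | zero => simp [countSeqCode, concatBlocks, countCode]
  | succ n ih => rw [countSeqCode, ih]; rfl

theorem countSeqCode_mod (n : ℕ) (hn : n < 64) : countSeqCode f n % 2 ^ 30 = countCode f n := by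
  rw [countSeqCode_eq, concatBlocks, Nat.mul_add_mod, Nat.mod_eq_of_lt (countCode_lt f n hn)]

theorem countSeqCode_mod_pow (m L : ℕ) (h : m + L < 64) (hL : 1 ≤ L) :
    countSeqCode f (m + L) % (2 ^ 30) ^ (m + 1) =
      concatBlocks (fun i => countCode f (i + L)) (m + 1) := by
  have key : ∀ k, countSeqCode f (L - 1 + k) = (2 ^ 30) ^ k * countSeqCode f (L - 1) +
      concatBlocks (fun i => countCode f (i + L)) k := by
    intro k
    induction k with
    | zero => simp [concatBlocks]
    | succ k ih =>
      rw [← add_assoc, countSeqCode, ih, concatBlocks, show L - 1 + k + 1 = k + L by omega]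
      ring
  rw [show m + L = L - 1 + (m + 1) by omega, key, Nat.mul_add_mod, Nat.mod_eq_of_lt]
  exact concatBlocks_lt _ _ fun i hi => countCode_lt f _ (by omega)

theorem unbalancedAt_eq_false (hf : ∀ a, BalancedAt f a) {n L : ℕ} (hn : n < 64) (hL : 1 ≤ L) :
    unbalancedAt n (countCode f n) (countSeqCode f n) L = false := by
  unfold unbalancedAt
  rcases Nat.lt_or_ge n L with h | h
  · simp [h]
  obtain ⟨m, rfl⟩ := Nat.exists_eq_add_of_le' h
  let d : ℕ → Fin 5 → ℕ := fun i x =>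
    1 + prefixCount f x (m + L) + prefixCount f x i - prefixCount f x m - prefixCount f x (i + L)
  let a : ℕ → ℕ := fun i => d i 0 + 64 * d i 1 + 4096 * d i 2 + 262144 * d i 3 + 16777216 * d i 4
  have hd : ∀ i x, d i x < 3 := by
    intro i x
    have := hf x m i L
    simp only [d]; omega
  have hmono : ∀ x, prefixCount f x m ≤ prefixCount f x (m + L) := by
    intro x; rw [prefixCount_add]; omega
  have hd' : ∀ i x, d i x + prefixCount f x (i + L) + prefixCount f x m =
      1 + prefixCount f x (m + L) + prefixCount f x i := by
    intro i x
    have := hf x i m L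
    simp only [d]; omega
  have hS : ∀ n, countCode f n = prefixCount f 0 n + 64 * prefixCount f 1 n +
      4096 * prefixCount f 2 n + 262144 * prefixCount f 3 n + 16777216 * prefixCount f 4 n := by
    intro n; rw [countCode_eq, Fin.sum_univ_five]; norm_num
  have ha : ∀ i, a i + countCode f (i + L) =
      (17043521 + countCode f (m + L) - countCode f m) + countCode f i := by
    intro i
    simp only [hS, a]
    have e0 := hd' i 0
    have e1 := hd' i 1
    have e2 := hd' i 2
    have e3 := hd' i 3
    have e4 := hd' i 4
    have m0 := hmono 0
    have m1 := hmono 1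
    have m2 := hmono 2
    have m3 := hmono 3
    have m4 := hmono 4
    clear * - e0 e1 e2 e3 e4 m0 m1 m2 m3 m4
    omega
  have hsmall : smallDigits (concatBlocks a (m + 1)) (concatBlocks (fun _ => 1) (m + 1)) = true := by
    refine smallDigits_concatBlocks a _ fun i _ => ⟨?_, ?_⟩
    · have h0 := hd i 0
      have h1 := hd i 1
      have h2 := hd i 2
      have h3 := hd i 3
      have h4 := hd i 4
      simp only [a]; norm_num; omega
    · exact block_digits ⟨_, hd i 0⟩ ⟨_, hd i 1⟩ ⟨_, hd i 2⟩ ⟨_, hd i 3⟩ ⟨_, hd i 4⟩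
  have hlin := concatBlocks_add_mul (k := m + 1) fun i _ => ha i
  have hw : windowDiffs (countCode f (m + L)) (countSeqCode f (m + L)) (countSeqCode f m)
      ((2 ^ 30) ^ (m + 1)) (concatBlocks (fun _ => 1) (m + 1)) = concatBlocks a (m + 1) := by
    change concatBlocks (fun _ => 1) (m + 1) *
      (17043521 + countCode f (m + L) - countSeqCode f m % 2 ^ 30) + countSeqCode f m -
        countSeqCode f (m + L) % (2 ^ 30) ^ (m + 1) = _
    rw [countSeqCode_mod_pow f m L hn hL, countSeqCode_mod f m (by omega), countSeqCode_eq f m]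
    omega
  have hk : Nat.sub (Nat.succ (m + L)) L = m + 1 := by
    change m + L + 1 - L = m + 1
    omega
  have hp : Nat.div (countSeqCode f (m + L)) (Nat.pow 1073741824 L) = countSeqCode f m := by
    have := countSeqCode_div f (m + L) L hn
    rwa [Nat.add_sub_cancel] at this
  have hR : Nat.div (Nat.pred (Nat.pow 1073741824 (m + 1))) 1073741823 =
      concatBlocks (fun _ => 1) (m + 1) := concatBlocks_one (m + 1)
  rw [hk, hp, hR, unbalancedAux]
  have hw' : windowDiffs (countCode f (m + L)) (countSeqCode f (m + L)) (countSeqCode f m)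
      (Nat.pow 1073741824 (m + 1)) (concatBlocks (fun _ => 1) (m + 1)) = concatBlocks a (m + 1) := hw
  rw [hw', hsmall]
  simp

theorem rejected_eq_false (h1 : AvoidsThreeHalves f) (h2 : ∀ a, BalancedAt f a) {n : ℕ}
    (hn : 1 ≤ n) (hn' : n < 64) :
    rejected n (wordCode f n) (countCode f n) (countSeqCode f n) = false := by
  simp [rejected, endsSomeRep, unbalanced, endsRep_eq_false f h1 hn,
    unbalancedAt_eq_false f h2 hn']

end Balance

/-- The nonzero base-`8` digit standing for a letter. -/
def letterCode (a : Fin 5) : ℕ := a + 1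

theorem exhausted_sound (m : ℕ) (U V : List (Fin 5)) (n : ℕ) (f : ℕ → Fin 5)
    (h1 : AvoidsThreeHalves f) (h2 : ∀ a, BalancedAt f a) (hU : ∀ j < n, f j ∈ U)
    (hUV : ∀ a, a ∈ U ∨ a ∈ V) (hdisj : (U ++ V).Nodup) (hn : n + m < 64) :
    exhausted m (U.map letterCode) (V.map letterCode) n (wordCode f n) (countCode f n)
      (countSeqCode f n) = false := by
  induction m generalizing U V n f with
  | zero => rfl
  | succ m ih =>
    by_contra h
    rw [Bool.not_eq_false] at h
    unfold exhausted at h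
    rw [Bool.and_eq_true, List.all_eq_true] at h
    obtain ⟨hold, hnew⟩ := h
    by_cases hfn : f n ∈ U
    · have h3 := hold (letterCode (f n)) (List.mem_map_of_mem hfn)
      have h4 := rejected_eq_false f h1 h2 (n := n + 1) (by omega) (by omega)
      have h5 := ih U V (n + 1) f h1 h2
        (fun j hj => (Nat.lt_succ_iff_lt_or_eq.mp hj).elim (hU j) fun e => e ▸ hfn) hUV hdisj
        (by omega)
      exact absurd h3 (by
        rw [Bool.not_eq_true]
        exact Bool.or_eq_false_iff.mpr ⟨h4, h5⟩)
    · cases V with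
      | nil => exact (hUV (f n)).elim hfn (by simp)
      | cons b V' =>
        have hb : b ∉ U := fun hb => by
          have := (List.nodup_append.mp hdisj).2.2 b hb b (by simp)
          exact this rfl
        let σ : Equiv.Perm (Fin 5) := Equiv.swap (f n) b
        let g : ℕ → Fin 5 := fun j => σ (f j)
        have hg : ∀ j < n, g j = f j := fun j hj =>
          Equiv.swap_apply_of_ne_of_ne (fun e => hfn (e ▸ hU j hj)) (fun e => hb (e ▸ hU j hj))
        have hgn : g n = b := Equiv.swap_apply_left _ _
        have g1 : AvoidsThreeHalves g := h1.comp_equiv σ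
        have g2 : ∀ a, BalancedAt g a := fun a => by
          have := (h2 (σ.symm a)).comp_equiv σ
          rwa [σ.apply_symm_apply] at this
        have hcodes : ∀ k ≤ n, wordCode g k = wordCode f k ∧ countCode g k = countCode f k ∧
            countSeqCode g k = countSeqCode f k := by
          intro k hk
          induction k with
          | zero => exact ⟨rfl, rfl, rfl⟩
          | succ k ihk =>
            obtain ⟨a1, a2, a3⟩ := ihk (by omega)
            simp [wordCode, countCode, countSeqCode, a1, a2, a3, hg k (by omega)]
        obtain ⟨c1, c2, c3⟩ := hcodes n le_rfl
        rw [← c1, ← c2, ← c3] at hnew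
        have h4 := rejected_eq_false g g1 g2 (n := n + 1) (by omega) (by omega)
        have h5 := ih (b :: U) V' (n + 1) g g1 g2
          (fun j hj => (Nat.lt_succ_iff_lt_or_eq.mp hj).elim
            (fun hj => by rw [hg j hj]; exact List.mem_cons_of_mem _ (hU j hj))
            fun e => by rw [e, hgn]; simp)
          (fun a => by have := hUV a; simp only [List.mem_cons] at this ⊢; tauto)
          ((List.perm_middle.nodup_iff).mp hdisj) (by omega)
        refine absurd hnew ?_
        rw [Bool.not_eq_true]
        have : letterCode b = letterCode (g n) := by rw [hgn]
        simp only [List.map_cons, this] at h5 ⊢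
        exact Bool.or_eq_false_iff.mpr ⟨h4, h5⟩

theorem not_avoidsThreeHalves_of_balanced {A : Type*} [Fintype A] [DecidableEq A]
    (hA : Fintype.card A = 5) (w : ℕ → A) (hw : ∀ a, BalancedAt w a) : ¬ AvoidsThreeHalves w := by
  intro h
  let e : A ≃ Fin 5 := Fintype.equivFinOfCardEq hA
  have := exhausted_sound 45 [] [0, 1, 2, 3, 4] 0 (fun n => e (w n)) (h.comp_equiv e)
    (fun a => by
      have := (hw (e.symm a)).comp_equiv e
      rwa [e.apply_symm_apply] at this)
    (by simp) (by decide) (by decide) (by norm_num)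
  exact Bool.false_ne_true (this.symm.trans exhausted_empty)

/-- The smallest possible critical exponent of an infinite balanced word over a 5-letter
alphabet is `3/2`: the word `x₅` over `{0,1,2,3,4}` is balanced with critical exponent
exactly `3/2` (attained), and every infinite balanced word over a 5-letter alphabet has
critical exponent at least `3/2`. -/
theorem least_critical_exponent_balanced_five_letters :
    ((∀ a : ℕ, a < 5 → ∀ i i' n : ℕ,
        ((x5occ a i n : ℤ) - (x5occ a i' n : ℤ)).natAbs ≤ 1) ∧
      IsGreatest {r : ℚ | ∃ i n p : ℕ, 1 ≤ n ∧ 1 ≤ p ∧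
        (∀ j, j + p < n → x5 (i + j) = x5 (i + j + p)) ∧ r = (n : ℚ) / (p : ℚ)}
        (3 / 2)) ∧
    ∀ (A : Type) [Fintype A] [DecidableEq A], Fintype.card A = 5 →
      ∀ w : ℕ → A,
        (∀ (a : A) (i i' n : ℕ),
          ((((Finset.range n).filter fun j => w (i + j) = a).card : ℤ) -
            (((Finset.range n).filter fun j => w (i' + j) = a).card : ℤ)).natAbs ≤ 1) →
        ∀ q : ℚ, q < 3 / 2 → ∃ i n p : ℕ, 1 ≤ n ∧ 1 ≤ p ∧
          (∀ j, j + p < n → w (i + j) = w (i + j + p)) ∧ q < (n : ℚ) / (p : ℚ) := by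
  refine ⟨⟨fun a ha => (balancedAt_iff x5 a).mp (balancedAt_x5 a ha),
    ⟨10, 6, 4, by norm_num, by norm_num, x5_ten_period, by norm_num⟩, ?_⟩, ?_⟩
  · rintro r ⟨i, n, p, -, hp, h, rfl⟩
    have h1 : (2 * n : ℚ) ≤ 3 * p := by exact_mod_cast exponent_x5_le hp h
    rw [div_le_iff₀ (by exact_mod_cast hp)]
    linarith
  · intro A _ _ hA w hw q hq
    have h := not_avoidsThreeHalves_of_balanced hA w fun a => (balancedAt_iff w a).mpr (hw a)
    unfold AvoidsThreeHalves at h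
    push Not at h
    obtain ⟨i, p, hp, h⟩ := h
    refine ⟨i, p + (p + 1) / 2, p, by omega, hp, fun j hj => h j (by omega), hq.trans_le ?_⟩
    rw [le_div_iff₀ (by exact_mod_cast hp)]
    have : ((3 * p : ℕ) : ℚ) ≤ ((2 * (p + (p + 1) / 2) : ℕ) : ℚ) := by
      exact_mod_cast (by omega : 3 * p ≤ 2 * (p + (p + 1) / 2))
    push_cast at *
    linarith
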